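/- Let n ≥ 1 be a natural number and λ a real number with λ ≠ 0, and set c = (−1)^{n+1}·n!·(1−λ). Define F(y) = (1/(λ^{n+1}·y^{n−1}))·(λ^n·y^n + ∑_{j=0}^{n−1} (−1)^{n−j}·(n!/j!)·(1−λ)·(λy)^j + c·e^{−λy}) for y > 0. Then for every y > 0, y − F(y) = ((λ−1)·n!/(λ^{n+1}·y^{n−1}))·f_{n+1}(λy); in particular, if λ > 1 then F(y) < y for all y > 0. -/

import Mathlib

open Finset

/-- The signed tail of the Taylor series of `e^{-x}`:
`f k x = (-1)^k ∑_{j=k}^∞ (-x)^j / j!`. -/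
noncomputable def f (k : ℕ) (x : ℝ) : ℝ :=
  (-1 : ℝ) ^ k * ∑' j : ℕ, (-x) ^ (k + j) / (Nat.factorial (k + j))

/-- Cao's first integral for the rotationally symmetric expanding
Kähler–Ricci soliton ODE on `ℂ^n`. -/
noncomputable def F (n : ℕ) (lam c : ℝ) (y : ℝ) : ℝ :=
  (1 / (lam ^ (n + 1) * y ^ (n - 1))) *
    (lam ^ n * y ^ n +
      ∑ j ∈ Finset.range n,
        (-1 : ℝ) ^ (n - j) * ((Nat.factorial n : ℝ) / (Nat.factorial j)) *
          (1 - lam) * (lam * y) ^ j +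
      c * Real.exp (-(lam * y)))

theorem f_eq (k : ℕ) (x : ℝ) :
    f k x = (-1 : ℝ) ^ k * (Real.exp (-x) - ∑ j ∈ Finset.range k, (-x) ^ j / (Nat.factorial j)) := by
  have hs : Summable (fun j : ℕ => (-x) ^ j / (Nat.factorial j : ℝ)) :=
    Real.summable_pow_div_factorial (-x)
  have h1 := hs.sum_add_tsum_nat_add k
  have h2 : Real.exp (-x) = ∑' j : ℕ, (-x) ^ j / (Nat.factorial j : ℝ) := by
    rw [Real.exp_eq_exp_ℝ, NormedSpace.exp_eq_tsum_div]
  unfold f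
  rw [h2, ← h1, add_sub_cancel_left]
  congr 1
  refine tsum_congr fun j => ?_
  rw [add_comm k j]

theorem f_deriv (k : ℕ) (x : ℝ) : HasDerivAt (f (k + 1)) (f k x) x := by
  have hf : f (k + 1) = fun x => (-1 : ℝ) ^ (k + 1) *
      (Real.exp (-x) - ∑ j ∈ Finset.range (k + 1), (-x) ^ j / (Nat.factorial j)) :=
    funext (f_eq (k + 1))
  rw [hf, f_eq]
  have he : HasDerivAt (fun x : ℝ => Real.exp (-x)) (-Real.exp (-x)) x := by
    simpa using (hasDerivAt_neg x).exp
  have hsum : HasDerivAt (fun x : ℝ => ∑ j ∈ Finset.range (k + 1), (-x) ^ j / (Nat.factorial j : ℝ))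
      (-∑ j ∈ Finset.range k, (-x) ^ j / (Nat.factorial j : ℝ)) x := by
    have h : HasDerivAt (fun x : ℝ => ∑ j ∈ Finset.range (k + 1), (-x) ^ j / (Nat.factorial j : ℝ))
      (∑ j ∈ Finset.range (k + 1), ((j : ℝ) * (-x) ^ (j - 1) * (-1)) / (Nat.factorial j : ℝ)) x :=
      HasDerivAt.fun_sum fun j _ => ((hasDerivAt_neg x).fun_pow j).div_const _
    convert h using 1
    rw [Finset.sum_range_succ', ← Finset.sum_neg_distrib]
    simp only [Nat.cast_zero, zero_mul, zero_div, add_zero]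
    refine Finset.sum_congr rfl fun j _ => ?_
    rw [Nat.factorial_succ, Nat.add_sub_cancel]
    push_cast
    have : (Nat.factorial j : ℝ) ≠ 0 := by positivity
    have : (j : ℝ) + 1 ≠ 0 := by positivity
    field_simp
  refine ((he.fun_sub hsum).const_mul ((-1 : ℝ) ^ (k + 1))).congr_deriv ?_
  ring

theorem f_pos (k : ℕ) : ∀ x : ℝ, 0 < x → 0 < f k x := by
  induction k with
  | zero => intro x _; rw [f_eq]; simp [Real.exp_pos]
  | succ k ih =>
    intro x hx
    have h0 : f (k + 1) 0 = 0 := by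
      rw [f_eq, Finset.sum_range_succ']
      simp
    have hm : StrictMonoOn (f (k + 1)) (Set.Ici 0) := by
      apply strictMonoOn_of_deriv_pos (convex_Ici 0)
      · exact fun z _ => (f_deriv k z).continuousAt.continuousWithinAt
      · intro z hz
        rw [interior_Ici] at hz
        rw [(f_deriv k z).deriv]
        exact ih z hz
    have := hm (Set.mem_Ici.2 le_rfl) (Set.mem_Ici.2 hx.le) hx
    rwa [h0] at this

theorem stmt_17 (n : ℕ) (hn : 1 ≤ n) (lam : ℝ) (hlam : lam ≠ 0)
    (c : ℝ) (hcval : c = (-1 : ℝ) ^ (n + 1) * (Nat.factorial n) * (1 - lam))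
    (y : ℝ) (hy : 0 < y) :
    y - F n lam c y =
      ((lam - 1) * (Nat.factorial n) / (lam ^ (n + 1) * y ^ (n - 1))) *
        f (n + 1) (lam * y) ∧
    (1 < lam → F n lam c y < y) := by
  have key : y - F n lam c y =
      ((lam - 1) * (Nat.factorial n) / (lam ^ (n + 1) * y ^ (n - 1))) *
        f (n + 1) (lam * y) := by
    have hS : ∑ j ∈ Finset.range n, (-1 : ℝ) ^ (n - j) * ((Nat.factorial n : ℝ) / (Nat.factorial j)) *
          (1 - lam) * (lam * y) ^ j = (-1 : ℝ) ^ n * (Nat.factorial n) * (1 - lam) *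
          ∑ j ∈ Finset.range n, (-(lam * y)) ^ j / (Nat.factorial j) := by
      rw [Finset.mul_sum]
      refine Finset.sum_congr rfl fun j hj => ?_
      have hj := (Finset.mem_range.1 hj).le
      have e : (-1 : ℝ) ^ (n - j) = (-1) ^ n * (-1) ^ j := by
        obtain ⟨m, rfl⟩ := Nat.exists_eq_add_of_le hj
        rw [Nat.add_sub_cancel_left, pow_add]
        have : (-1 : ℝ) ^ j * (-1) ^ j = 1 := by rw [← mul_pow]; simp
        linear_combination (-(-1 : ℝ) ^ m) * this
      rw [e, neg_pow (lam * y) j]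
      ring
    have hq : (-1 : ℝ) ^ n * (-1) ^ n = 1 := by rw [← mul_pow]; simp
    have hfac : (Nat.factorial n : ℝ) ≠ 0 := by positivity
    rw [f_eq, Finset.sum_range_succ]
    unfold F
    rw [hS, hcval]
    generalize (∑ j ∈ Finset.range n, (-(lam * y)) ^ j / (Nat.factorial j : ℝ)) = S
    generalize Real.exp (-(lam * y)) = E
    rw [neg_pow (lam * y) n, mul_pow]
    have hD : lam ^ (n + 1) * y ^ (n - 1) ≠ 0 := by positivity
    have hy' : y = lam ^ (n + 1) * y ^ n / (lam ^ (n + 1) * y ^ (n - 1)) := by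
      obtain ⟨m, rfl⟩ := Nat.exists_eq_add_of_le hn
      rw [eq_div_iff hD, Nat.add_sub_cancel_left]
      ring
    have hl : lam ^ (n + 1) = lam ^ n * lam := pow_succ _ _
    have hd : (Nat.factorial n : ℝ) * ((-1) ^ n * (lam ^ n * y ^ n) / (Nat.factorial n : ℝ))
        = (-1) ^ n * (lam ^ n * y ^ n) := by field_simp
    generalize hT : (-1 : ℝ) ^ n * (lam ^ n * y ^ n) / (Nat.factorial n : ℝ) = T at *
    have hd2 : (-1 : ℝ) ^ n * ((Nat.factorial n : ℝ) * T) = lam ^ n * y ^ n := by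
      rw [hd, ← mul_assoc, hq, one_mul]
    rw [one_div_mul_eq_div, div_mul_eq_mul_div]
    conv_lhs => lhs; rw [hy']
    rw [← sub_div]
    congr 1
    rw [hl, pow_succ (-1 : ℝ) n]
    linear_combination (1 - lam) * hd2
  refine ⟨key, fun h => ?_⟩
  have h1 := f_pos (n + 1) (lam * y) (by positivity)
  have : 0 < y - F n lam c y := by
    rw [key]
    have : 0 < lam - 1 := by linarith
    have : 0 < lam := by linarith
    positivity
  linarith
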